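/- For all distributions μ1, μ2 ∈ D(Proc), every p ∈ [0,1], and every predicate φ ⊆ Proc: sup O^{p·μ1+(1−p)·μ2}_φ = p·sup O^{μ1}_φ + (1−p)·sup O^{μ2}_φ, and inf O^{p·μ1+(1−p)·μ2}_φ = p·inf O^{μ1}_φ + (1−p)·inf O^{μ2}_φ. -/

import Mathlib

open scoped Classical

/-- Finitely supported probability distributions on `α`. -/
structure FinDist (α : Type) where
  toFun : α → ℝ
  nonneg : ∀ a, 0 ≤ toFun a
  finite_support : (Function.support toFun).Finite
  sum_one : ∑ᶠ a, toFun a = 1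

namespace FinDist

/-- The probability that a predicate (set) `φ` is satisfied under `μ`. -/
noncomputable def mass {α : Type} (μ : FinDist α) (φ : Set α) : ℝ :=
  ∑ᶠ a ∈ φ, μ.toFun a

end FinDist

section Transitions

variable {Proc Act : Type}

/-- A single probabilistic transition between distributions: `μ →(α,p) ν` iff
`0 < p ≤ 1` and there are `P ∈ supp μ` and `ρ` with `P →α ρ` (single-step relation
`step`) and `ν = μ + μ(P)·p·(ρ − δ_P)`. -/
def DStep (step : Proc → Act → FinDist Proc → Prop)
    (μ : FinDist Proc) (α : Act) (p : ℝ) (ν : FinDist Proc) : Prop :=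
  0 < p ∧ p ≤ 1 ∧
    ∃ P ρ, 0 < μ.toFun P ∧ step P α ρ ∧
      ∀ Q, ν.toFun Q = μ.toFun Q + μ.toFun P * p * (ρ.toFun Q - (if Q = P then 1 else 0))

/-- Probabilistic transition sequence `μ →π ν` along a word `π`. -/
def DSeq (step : Proc → Act → FinDist Proc → Prop) :
    FinDist Proc → List (Act × ℝ) → FinDist Proc → Prop
  | μ, [], ν => ν = μ
  | μ, s :: π, ν => ∃ μ', DStep step μ s.1 s.2 μ' ∧ DSeq step μ' π ν

end Transitions
section Testing

variable {Proc Act : Type}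

/-- Internal transition sequence `μ ⇝ ν`: a finite composition of `→(τ,p)` steps. -/
def Internal (step : Proc → Act → FinDist Proc → Prop) (tau : Act)
    (μ ν : FinDist Proc) : Prop :=
  ∃ π : List (Act × ℝ), (∀ s ∈ π, s.1 = tau) ∧ DSeq step μ π ν

/-- Internal transition sequence with a degenerate witness (`every step has p = 1`),
written `μ →τ* ν`. -/
def Degenerate (step : Proc → Act → FinDist Proc → Prop) (tau : Act)
    (μ ν : FinDist Proc) : Prop :=
  ∃ π : List (Act × ℝ), (∀ s ∈ π, s.1 = tau ∧ s.2 = 1) ∧ DSeq step μ π ν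

/-- Testing outcomes `O^μ_φ = { ν(φ) : μ ⇝ ν }`. -/
def Outcomes (step : Proc → Act → FinDist Proc → Prop) (tau : Act)
    (φ : Set Proc) (μ : FinDist Proc) : Set ℝ :=
  {x | ∃ ν, Internal step tau μ ν ∧ x = ν.mass φ}

end Testing

theorem FinDist.ext_fun {α : Type} {μ ν : FinDist α} (h : ∀ a, μ.toFun a = ν.toFun a) : μ = ν := by
  cases μ; cases ν
  have := funext h
  simp only at this
  subst this
  rfl

theorem finsum_lin {α : Type} (f g : α → ℝ) (hf : (Function.support f).Finite)
    (hg : (Function.support g).Finite) (a b : ℝ) :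
    (Function.support (fun x => a * f x + b * g x)).Finite ∧
    ∑ᶠ x, (a * f x + b * g x) = a * ∑ᶠ x, f x + b * ∑ᶠ x, g x := by
  have h1 : (Function.support (fun x => a * f x)).Finite :=
    hf.subset (by intro x hx; simp at hx ⊢; tauto)
  have h2 : (Function.support (fun x => b * g x)).Finite :=
    hg.subset (by intro x hx; simp at hx ⊢; tauto)
  refine ⟨(h1.union h2).subset (Function.support_add _ _), ?_⟩
  rw [finsum_add_distrib h1 h2, ← mul_finsum f a, ← mul_finsum g b]

noncomputable def FinDist.mix {α : Type} (p : ℝ) (hp0 : 0 ≤ p) (hp1 : p ≤ 1)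
    (μ ν : FinDist α) : FinDist α where
  toFun := fun x => p * μ.toFun x + (1 - p) * ν.toFun x
  nonneg := fun a => add_nonneg (mul_nonneg hp0 (μ.nonneg a))
    (mul_nonneg (by linarith) (ν.nonneg a))
  finite_support := (finsum_lin _ _ μ.finite_support ν.finite_support _ _).1
  sum_one := by
    rw [(finsum_lin _ _ μ.finite_support ν.finite_support _ _).2, μ.sum_one, ν.sum_one]; ring

theorem FinDist.mass_mix {α : Type} {p : ℝ} {μ1 μ2 μ : FinDist α}
    (h : ∀ Q, μ.toFun Q = p * μ1.toFun Q + (1 - p) * μ2.toFun Q) (φ : Set α) :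
    μ.mass φ = p * μ1.mass φ + (1 - p) * μ2.mass φ := by
  have key : ∀ ν : FinDist α, ν.mass φ = ∑ᶠ a, φ.indicator ν.toFun a := fun ν =>
    finsum_mem_def _ _
  have fin : ∀ ν : FinDist α, (Function.support (φ.indicator ν.toFun)).Finite := fun ν =>
    ν.finite_support.subset (by intro x hx; simp at hx ⊢; tauto)
  rw [key, key, key, ← (finsum_lin _ _ (fin μ1) (fin μ2) _ _).2]
  refine finsum_congr fun a => ?_
  by_cases ha : a ∈ φ <;> simp [ha, h]

theorem FinDist.mass_nonneg {α : Type} (μ : FinDist α) (φ : Set α) : 0 ≤ μ.mass φ :=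
  finsum_nonneg fun a => finsum_nonneg fun _ => μ.nonneg a

theorem FinDist.mass_le_one {α : Type} (μ : FinDist α) (φ : Set α) : μ.mass φ ≤ 1 := by
  have fin : (Function.support (φ.indicator μ.toFun)).Finite :=
    μ.finite_support.subset (by intro x hx; simp at hx ⊢; tauto)
  have h := (finsum_lin _ _ μ.finite_support fin 1 (-1)).2
  have h' : 0 ≤ ∑ᶠ x, (1 * μ.toFun x + (-1) * φ.indicator μ.toFun x) := by
    refine finsum_nonneg fun a => ?_
    have := μ.nonneg a
    by_cases ha : a ∈ φ <;> simp [ha, this]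
  rw [h, μ.sum_one] at h'
  rw [FinDist.mass, finsum_mem_def]
  linarith

theorem exists_stepTo {α : Type} (μ ρ : FinDist α) (P : α) (q : ℝ) (h0 : 0 < q) (h1 : q ≤ 1) :
    ∃ ν : FinDist α, ∀ Q, ν.toFun Q =
      μ.toFun Q + μ.toFun P * q * (ρ.toFun Q - (if Q = P then 1 else 0)) := by
  have hd : (Function.support (fun Q : α => if Q = P then (1 : ℝ) else 0)).Finite :=
    (Set.finite_singleton P).subset (by intro x hx; simpa using hx)
  have hs : ∑ᶠ Q : α, (if Q = P then (1 : ℝ) else 0) = 1 := by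
    rw [finsum_eq_single _ P (by intro x hx; simp [hx])]; simp
  have a := finsum_lin _ _ ρ.finite_support hd 1 (-1)
  have b := finsum_lin _ _ μ.finite_support a.1 1 (μ.toFun P * q)
  have e : (fun Q => μ.toFun Q + μ.toFun P * q * (ρ.toFun Q - (if Q = P then 1 else 0))) =
    (fun Q => 1 * μ.toFun Q + μ.toFun P * q *
      (1 * ρ.toFun Q + (-1) * (if Q = P then 1 else 0))) := by
    funext Q; ring
  refine ⟨⟨fun Q => μ.toFun Q + μ.toFun P * q * (ρ.toFun Q - (if Q = P then 1 else 0)),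
    ?_, ?_, ?_⟩, fun _ => rfl⟩
  · intro Q
    have hμ := μ.nonneg P
    have hρ := mul_nonneg (mul_nonneg hμ h0.le) (ρ.nonneg Q)
    split_ifs with h
    · subst h; nlinarith
    · have := μ.nonneg Q; nlinarith
  · rw [e]; exact b.1
  · rw [e, b.2, a.2, μ.sum_one, ρ.sum_one, hs]; ring

section Aux
variable {Proc Act : Type} {step : Proc → Act → FinDist Proc → Prop} {tau : Act}

theorem Internal.rfl' (μ : FinDist Proc) : Internal step tau μ μ := ⟨[], by simp, rfl⟩

theorem Internal.head {μ μ' ν : FinDist Proc} {q : ℝ} (h : DStep step μ tau q μ')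
    (h' : Internal step tau μ' ν) : Internal step tau μ ν := by
  obtain ⟨π, h1, h2⟩ := h'
  exact ⟨(tau, q) :: π, by simpa using h1, μ', h, h2⟩

theorem Internal.induct {C : FinDist Proc → FinDist Proc → Prop} (h0 : ∀ μ, C μ μ)
    (h1 : ∀ μ μ' ν q, DStep step μ tau q μ' → Internal step tau μ' ν → C μ' ν → C μ ν)
    {μ ν : FinDist Proc} (h : Internal step tau μ ν) : C μ ν := by
  obtain ⟨π, ht, hs⟩ := h
  induction π generalizing μ with
  | nil => cases hs; exact h0 _
  | cons s π ih =>
    obtain ⟨μ', hd, hs⟩ := hs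
    have e : s.1 = tau := ht s (by simp)
    rw [e] at hd
    have ht' : ∀ s ∈ π, s.1 = tau := fun t h => ht t (by simp [h])
    exact h1 _ _ _ _ hd ⟨π, ht', hs⟩ (ih ht' hs)

theorem Internal.trans' {μ ν κ : FinDist Proc} (h : Internal step tau μ ν) :
    Internal step tau ν κ → Internal step tau μ κ :=
  Internal.induct (C := fun μ ν => Internal step tau ν κ → Internal step tau μ κ)
    (fun _ h => h) (fun _ _ _ _ hd _ ih h => Internal.head hd (ih h)) h

theorem exists_internal_step (μ ρ : FinDist Proc) (P : Proc) (q : ℝ) (h0 : 0 < q) (h1 : q ≤ 1)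
    (hs : step P tau ρ) :
    ∃ ν : FinDist Proc, (∀ κ, Internal step tau ν κ → Internal step tau μ κ) ∧
     ∀ Q, ν.toFun Q =
      μ.toFun Q + μ.toFun P * q * (ρ.toFun Q - (if Q = P then 1 else 0)) := by
  obtain ⟨ν, hν⟩ := exists_stepTo μ ρ P q h0 h1
  refine ⟨ν, fun κ hκ => ?_, hν⟩
  rcases (μ.nonneg P).eq_or_lt with h | h
  · have : ν = μ := FinDist.ext_fun fun Q => by rw [hν, ← h]; ring
    rwa [← this]
  · exact Internal.head ⟨h0, h1, P, ρ, h, hs, hν⟩ hκ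

theorem Internal.split {p : ℝ} {μ ν : FinDist Proc} (h : Internal step tau μ ν) :
    ∀ μ1 μ2 : FinDist Proc,
    (∀ Q, μ.toFun Q = p * μ1.toFun Q + (1 - p) * μ2.toFun Q) →
    ∃ ν1 ν2, Internal step tau μ1 ν1 ∧ Internal step tau μ2 ν2 ∧
      ∀ Q, ν.toFun Q = p * ν1.toFun Q + (1 - p) * ν2.toFun Q := by
  refine Internal.induct (C := fun μ ν => ∀ μ1 μ2 : FinDist Proc,
    (∀ Q, μ.toFun Q = p * μ1.toFun Q + (1 - p) * μ2.toFun Q) →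
    ∃ ν1 ν2, Internal step tau μ1 ν1 ∧ Internal step tau μ2 ν2 ∧
      ∀ Q, ν.toFun Q = p * ν1.toFun Q + (1 - p) * ν2.toFun Q) ?_ ?_ h
  · intro μ μ1 μ2 h
    exact ⟨μ1, μ2, Internal.rfl' _, Internal.rfl' _, h⟩
  · rintro μ μ' ν q ⟨h0, h1, P, ρ, -, hs, he⟩ - ih μ1 μ2 hm
    obtain ⟨κ1, t1, e1⟩ := exists_internal_step μ1 ρ P q h0 h1 hs
    obtain ⟨κ2, t2, e2⟩ := exists_internal_step μ2 ρ P q h0 h1 hs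
    obtain ⟨ν1, ν2, i1, i2, e⟩ := ih κ1 κ2 (fun Q => by rw [he, e1, e2, hm, hm]; ring)
    exact ⟨ν1, ν2, t1 _ i1, t2 _ i2, e⟩

theorem Internal.left {p : ℝ} (hp0 : 0 ≤ p) (hp1 : p ≤ 1) (μ2 : FinDist Proc)
    {μ1 ν1 : FinDist Proc} (h : Internal step tau μ1 ν1) : 
    ∀ μ : FinDist Proc,
    (∀ Q, μ.toFun Q = p * μ1.toFun Q + (1 - p) * μ2.toFun Q) →
    ∃ ν, Internal step tau μ ν ∧
      ∀ Q, ν.toFun Q = p * ν1.toFun Q + (1 - p) * μ2.toFun Q := by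
  refine Internal.induct (C := fun μ1 ν1 => ∀ μ : FinDist Proc,
    (∀ Q, μ.toFun Q = p * μ1.toFun Q + (1 - p) * μ2.toFun Q) →
    ∃ ν, Internal step tau μ ν ∧
      ∀ Q, ν.toFun Q = p * ν1.toFun Q + (1 - p) * μ2.toFun Q) ?_ ?_ h
  · intro μ1 μ h
    exact ⟨μ, Internal.rfl' _, h⟩
  · rintro μ1 μ1' ν1 q ⟨h0, h1, P, ρ, hP, hs, he⟩ - ih μ hm
    rcases hp0.eq_or_lt with hp | hp
    · exact ih μ (fun Q => by rw [hm, ← hp]; ring)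
    · have hpos : 0 < p * μ1.toFun P := mul_pos hp hP
      have hle : p * μ1.toFun P ≤ μ.toFun P := by
        rw [hm]; have := mul_nonneg (sub_nonneg.2 hp1) (μ2.nonneg P); linarith
      have hμP : 0 < μ.toFun P := lt_of_lt_of_le hpos hle
      obtain ⟨κ, t, e⟩ := exists_internal_step μ ρ P (p * μ1.toFun P * q / μ.toFun P)
        (by positivity) (by rw [div_le_one hμP]; nlinarith) hs
      rw [mul_div_cancel₀ _ hμP.ne'] at e
      obtain ⟨ν, i, e'⟩ := ih κ (fun Q => by rw [e, he, hm]; ring)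
      exact ⟨ν, t _ i, e'⟩

open scoped Pointwise in
theorem outcomes_eq (step : Proc → Act → FinDist Proc → Prop) (tau : Act)
    (μ1 μ2 μ : FinDist Proc) (p : ℝ) (hp0 : 0 ≤ p) (hp1 : p ≤ 1) (φ : Set Proc)
    (hμ : ∀ Q, μ.toFun Q = p * μ1.toFun Q + (1 - p) * μ2.toFun Q) :
    Outcomes step tau φ μ =
      p • Outcomes step tau φ μ1 + (1 - p) • Outcomes step tau φ μ2 := by
  ext x
  simp only [Set.mem_add, Set.mem_smul_set]
  constructor
  · rintro ⟨ν, h, rfl⟩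
    obtain ⟨ν1, ν2, i1, i2, e⟩ := h.split μ1 μ2 hμ
    exact ⟨_, ⟨_, ⟨ν1, i1, rfl⟩, rfl⟩, _, ⟨_, ⟨ν2, i2, rfl⟩, rfl⟩, (FinDist.mass_mix e φ).symm⟩
  · rintro ⟨_, ⟨_, ⟨ν1, i1, rfl⟩, rfl⟩, _, ⟨_, ⟨ν2, i2, rfl⟩, rfl⟩, rfl⟩
    obtain ⟨κ, t, e⟩ := i1.left hp0 hp1 μ2 μ hμ
    obtain ⟨ν, t', e'⟩ := i2.left (p := 1 - p) (by linarith) (by linarith) ν1 κ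
      (fun Q => by rw [e]; ring)
    exact ⟨ν, t.trans' t',
      (FinDist.mass_mix (p := p) (fun Q => by rw [e']; ring) φ).symm⟩

theorem outcomes_props (step : Proc → Act → FinDist Proc → Prop) (tau : Act)
    (μ : FinDist Proc) (φ : Set Proc) : (Outcomes step tau φ μ).Nonempty ∧
    BddAbove (Outcomes step tau φ μ) ∧ BddBelow (Outcomes step tau φ μ) := by
  refine ⟨⟨_, μ, Internal.rfl' _, rfl⟩, ⟨1, ?_⟩, ⟨0, ?_⟩⟩
  · rintro _ ⟨ν, -, rfl⟩; exact ν.mass_le_one φ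
  · rintro _ ⟨ν, -, rfl⟩; exact ν.mass_nonneg φ

end Aux

/-- Suprema and infima of testing outcomes are linear with respect
to convex combinations. -/
theorem sup_inf_outcomes_convex_combination
    {Proc Act : Type} (step : Proc → Act → FinDist Proc → Prop) (tau : Act)
    (μ1 μ2 μ : FinDist Proc) (p : ℝ) (hp0 : 0 ≤ p) (hp1 : p ≤ 1)
    (φ : Set Proc)
    (hμ : ∀ Q, μ.toFun Q = p * μ1.toFun Q + (1 - p) * μ2.toFun Q) :
    sSup (Outcomes step tau φ μ) =
        p * sSup (Outcomes step tau φ μ1) + (1 - p) * sSup (Outcomes step tau φ μ2) ∧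
    sInf (Outcomes step tau φ μ) =
        p * sInf (Outcomes step tau φ μ1) + (1 - p) * sInf (Outcomes step tau φ μ2) := by
  obtain ⟨n1, a1, b1⟩ := outcomes_props step tau μ1 φ
  obtain ⟨n2, a2, b2⟩ := outcomes_props step tau μ2 φ
  have hq : 0 ≤ 1 - p := by linarith
  rw [outcomes_eq step tau μ1 μ2 μ p hp0 hp1 φ hμ]
  constructor
  · rw [csSup_add n1.smul_set (a1.smul_of_nonneg hp0) n2.smul_set (a2.smul_of_nonneg hq),
      Real.sSup_smul_of_nonneg hp0, Real.sSup_smul_of_nonneg hq]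
    rfl
  · rw [csInf_add n1.smul_set (b1.smul_of_nonneg hp0) n2.smul_set (b2.smul_of_nonneg hq),
      Real.sInf_smul_of_nonneg hp0, Real.sInf_smul_of_nonneg hq]
    rfl
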